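/- The function f_p(x) = ((x^p + 1)/2)^{1/p} is matrix monotone (operator monotone on (0,∞)) if and only if −1 ≤ p ≤ 1 (with f_0(x) = √x by continuity). -/

import Mathlib

/-- `f` is matrix (operator) monotone on `(0,∞)`: for positive definite real matrices of
every size, `A ≤ B` in the Loewner order implies `f(A) ≤ f(B)`, where `f` is applied via
the hermitian functional calculus. -/
def OperatorMonotoneOnPos (f : ℝ → ℝ) : Prop :=
  ∀ (n : ℕ) (A B : Matrix (Fin n) (Fin n) ℝ) (hA : A.PosDef) (hB : B.PosDef),
    (B - A).PosSemidef → (hB.1.cfc f - hA.1.cfc f).PosSemidef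

/-- The binomial (power) mean `f_p(x) = ((x^p + 1)/2)^{1/p}`, with `f_0(x) = √x`
by continuity. -/
noncomputable def binomialMean (p x : ℝ) : ℝ :=
  if p = 0 then Real.sqrt x else ((x ^ p + 1) / 2) ^ (1 / p)

open Matrix Filter Topology MeasureTheory

theorem Matrix.PosDef.inv_sub_inv_posSemidef {n : ℕ} {P Q : Matrix (Fin n) (Fin n) ℝ}
    (hP : P.PosDef) (hQ : Q.PosDef) (h : (Q - P).PosSemidef) : (P⁻¹ - Q⁻¹).PosSemidef := by
  have hu : IsUnit P.det := (Matrix.isUnit_iff_isUnit_det _).1 hP.isUnit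
  have hiu : Invertible P⁻¹ := hP.inv.isUnit.invertible
  have hQi : Invertible Q := hQ.isUnit.invertible
  have h1 := Matrix.PosDef.fromBlocks₂₂ Q (1 : Matrix (Fin n) (Fin n) ℝ) hP.inv
  have h2 := Matrix.PosDef.fromBlocks₁₁ (1 : Matrix (Fin n) (Fin n) ℝ) P⁻¹ hQ
  simp only [conjTranspose_one, Matrix.one_mul, Matrix.mul_one,
    Matrix.nonsing_inv_nonsing_inv _ hu] at h1 h2
  exact h2.1 (h1.2 h)

theorem Matrix.IsHermitian.dotProduct_cfc_mulVec {n : ℕ} {A : Matrix (Fin n) (Fin n) ℝ}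
    (hA : A.IsHermitian) (f : ℝ → ℝ) (v : Fin n → ℝ) :
    v ⬝ᵥ (hA.cfc f *ᵥ v) = ∑ i, f (hA.eigenvalues i) *
      ((star (hA.eigenvectorUnitary : Matrix (Fin n) (Fin n) ℝ) *ᵥ v) i) ^ 2 := by
  rw [Matrix.IsHermitian.cfc, Unitary.conjStarAlgAut_apply, ← Matrix.mulVec_mulVec,
    ← Matrix.mulVec_mulVec, Matrix.dotProduct_mulVec, ← Matrix.mulVec_transpose]
  rw [show (hA.eigenvectorUnitary : Matrix (Fin n) (Fin n) ℝ)ᵀ =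
    star (hA.eigenvectorUnitary : Matrix (Fin n) (Fin n) ℝ) from by
      rw [Matrix.star_eq_conjTranspose, Matrix.conjTranspose_eq_transpose_of_trivial]]
  simp only [dotProduct, Matrix.mulVec_diagonal]
  refine Finset.sum_congr rfl fun i _ ↦ ?_
  simp
  ring

theorem Matrix.IsHermitian.isHermitian_cfc {n : ℕ} {A : Matrix (Fin n) (Fin n) ℝ}
    (hA : A.IsHermitian) (f : ℝ → ℝ) : (hA.cfc f).IsHermitian := by
  rw [← hA.cfc_eq]
  exact cfc_predicate f A

theorem Matrix.IsHermitian.cfc_sub_cfc_posSemidef_iff {n : ℕ} {A B : Matrix (Fin n) (Fin n) ℝ}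
    (hA : A.IsHermitian) (hB : B.IsHermitian) (f : ℝ → ℝ) :
    (hB.cfc f - hA.cfc f).PosSemidef ↔
      ∀ v : Fin n → ℝ, v ⬝ᵥ (hA.cfc f *ᵥ v) ≤ v ⬝ᵥ (hB.cfc f *ᵥ v) := by
  rw [Matrix.posSemidef_iff_dotProduct_mulVec]
  simp only [star_trivial, Matrix.sub_mulVec, dotProduct_sub, sub_nonneg, and_iff_right_iff_imp]
  exact fun _ ↦ (hB.isHermitian_cfc f).sub (hA.isHermitian_cfc f)

theorem Matrix.PosDef.cfc_congr_pos {n : ℕ} {A : Matrix (Fin n) (Fin n) ℝ}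
    (hA : A.PosDef) {f g : ℝ → ℝ} (h : ∀ x, 0 < x → f x = g x) : hA.1.cfc f = hA.1.cfc g := by
  have : f ∘ hA.1.eigenvalues = g ∘ hA.1.eigenvalues := funext fun i ↦ h _ (hA.eigenvalues_pos i)
  rw [Matrix.IsHermitian.cfc, Matrix.IsHermitian.cfc, this]

theorem Matrix.IsHermitian.spectrum_continuousOn {n : ℕ} (A : Matrix (Fin n) (Fin n) ℝ)
    (f : ℝ → ℝ) : ContinuousOn f (spectrum ℝ A) :=
  (Matrix.finite_real_spectrum (A := A)).continuousOn f

theorem Matrix.PosDef.pos_of_mem_spectrum {n : ℕ} {A : Matrix (Fin n) (Fin n) ℝ}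
    (hA : A.PosDef) {x : ℝ} (hx : x ∈ spectrum ℝ A) : 0 < x := by
  rw [hA.1.spectrum_real_eq_range_eigenvalues] at hx
  obtain ⟨i, rfl⟩ := hx
  exact hA.eigenvalues_pos i

theorem Matrix.IsHermitian.cfc_id' {n : ℕ} {A : Matrix (Fin n) (Fin n) ℝ}
    (hA : A.IsHermitian) : hA.cfc (fun x ↦ x) = A :=
  (hA.cfc_eq _).symm.trans (_root_.cfc_id' ℝ A hA)

theorem Matrix.IsHermitian.cfc_const {n : ℕ} {A : Matrix (Fin n) (Fin n) ℝ}
    (hA : A.IsHermitian) (c : ℝ) : hA.cfc (fun _ ↦ c) = algebraMap ℝ _ c :=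
  (hA.cfc_eq _).symm.trans (_root_.cfc_const c A hA)

theorem Matrix.PosDef.cfc_inv {n : ℕ} {A : Matrix (Fin n) (Fin n) ℝ}
    (hA : A.PosDef) {f : ℝ → ℝ} (hf : ∀ x, 0 < x → 0 < f x) :
    hA.1.cfc (fun x ↦ (f x)⁻¹) = (hA.1.cfc f)⁻¹ := by
  rw [← hA.1.cfc_eq, ← hA.1.cfc_eq, Matrix.nonsing_inv_eq_ringInverse]
  exact _root_.cfc_inv f A (fun x hx ↦ (hf x (hA.pos_of_mem_spectrum hx)).ne')
    (Matrix.IsHermitian.spectrum_continuousOn A f) hA.1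

theorem Matrix.IsHermitian.cfc_add {n : ℕ} {A : Matrix (Fin n) (Fin n) ℝ}
    (hA : A.IsHermitian) (f g : ℝ → ℝ) :
    hA.cfc (fun x ↦ f x + g x) = hA.cfc f + hA.cfc g := by
  simp only [← hA.cfc_eq]
  exact _root_.cfc_add A f g (Matrix.IsHermitian.spectrum_continuousOn A f)
    (Matrix.IsHermitian.spectrum_continuousOn A g)

theorem Matrix.IsHermitian.cfc_const_mul_id {n : ℕ} {A : Matrix (Fin n) (Fin n) ℝ}
    (hA : A.IsHermitian) (c : ℝ) : hA.cfc (fun x ↦ c * x) = c • A :=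
  (hA.cfc_eq _).symm.trans (_root_.cfc_const_mul_id c A hA)

theorem Matrix.PosDef.cfc_inv_arg {n : ℕ} {A : Matrix (Fin n) (Fin n) ℝ}
    (hA : A.PosDef) (f : ℝ → ℝ) :
    hA.1.cfc (fun x ↦ f x⁻¹) = hA.inv.1.cfc f := by
  have hfin : ((fun x : ℝ ↦ x⁻¹) '' spectrum ℝ A).Finite :=
    (Matrix.finite_real_spectrum (A := A)).image _
  have hinv : cfc (fun x : ℝ ↦ x⁻¹) A = A⁻¹ := by
    have := hA.cfc_inv (f := fun x ↦ x) fun _ h ↦ h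
    rw [hA.1.cfc_id'] at this
    exact (hA.1.cfc_eq _).trans this
  rw [← hA.1.cfc_eq, ← hA.inv.1.cfc_eq, ← hinv]
  exact cfc_comp' f (fun x ↦ x⁻¹) A (hfin.continuousOn f)
    (Matrix.IsHermitian.spectrum_continuousOn A _) hA.1

theorem Matrix.PosDef.posDef_cfc {n : ℕ} {A : Matrix (Fin n) (Fin n) ℝ}
    (hA : A.PosDef) {f : ℝ → ℝ} (hf : ∀ x, 0 < x → 0 < f x) : (hA.1.cfc f).PosDef := by
  have hU : IsUnit (hA.1.eigenvectorUnitary : Matrix (Fin n) (Fin n) ℝ) :=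
    Unitary.isUnit_coe
  rw [Matrix.IsHermitian.cfc, Unitary.conjStarAlgAut_apply,
    Matrix.IsUnit.posDef_star_right_conjugate_iff hU]
  exact Matrix.PosDef.diagonal fun i ↦ hf _ (hA.eigenvalues_pos i)

namespace OperatorMonotoneOnPos

theorem congr {f g : ℝ → ℝ} (hf : OperatorMonotoneOnPos f) (h : ∀ x, 0 < x → f x = g x) :
    OperatorMonotoneOnPos g := by
  intro n A B hA hB hAB
  rw [← hA.cfc_congr_pos h, ← hB.cfc_congr_pos h]
  exact hf n A B hA hB hAB

theorem of_tendsto {F : ℕ → ℝ → ℝ} {f : ℝ → ℝ} (hF : ∀ k, OperatorMonotoneOnPos (F k))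
    (h : ∀ x, 0 < x → Tendsto (fun k ↦ F k x) atTop (𝓝 (f x))) : OperatorMonotoneOnPos f := by
  intro n A B hA hB hAB
  rw [Matrix.IsHermitian.cfc_sub_cfc_posSemidef_iff]
  intro v
  have key : ∀ (C : Matrix (Fin n) (Fin n) ℝ) (hC : C.PosDef),
      Tendsto (fun k ↦ v ⬝ᵥ (hC.1.cfc (F k) *ᵥ v)) atTop (𝓝 (v ⬝ᵥ (hC.1.cfc f *ᵥ v))) := by
    intro C hC
    simp only [Matrix.IsHermitian.dotProduct_cfc_mulVec]
    exact tendsto_finsetSum _ fun i _ ↦ (h _ (hC.eigenvalues_pos i)).mul_const _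
  exact le_of_tendsto_of_tendsto' (key A hA) (key B hB) fun k ↦
    (Matrix.IsHermitian.cfc_sub_cfc_posSemidef_iff _ _ _).1 (hF k n A B hA hB hAB) v

theorem integral {μ : Measure ℝ} {F : ℝ → ℝ → ℝ} (hF : ∀ᵐ t ∂μ, OperatorMonotoneOnPos (F t))
    (h : ∀ x, 0 < x → Integrable (fun t ↦ F t x) μ) :
    OperatorMonotoneOnPos fun x ↦ ∫ t, F t x ∂μ := by
  intro n A B hA hB hAB
  rw [Matrix.IsHermitian.cfc_sub_cfc_posSemidef_iff]
  intro v
  have hint : ∀ (C : Matrix (Fin n) (Fin n) ℝ) (hC : C.PosDef),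
      Integrable (fun t ↦ v ⬝ᵥ (hC.1.cfc (F t) *ᵥ v)) μ := by
    intro C hC
    simp only [Matrix.IsHermitian.dotProduct_cfc_mulVec]
    exact integrable_finsetSum _ fun i _ ↦ (h _ (hC.eigenvalues_pos i)).mul_const _
  have key : ∀ (C : Matrix (Fin n) (Fin n) ℝ) (hC : C.PosDef),
      v ⬝ᵥ (hC.1.cfc (fun x ↦ ∫ t, F t x ∂μ) *ᵥ v) = ∫ t, v ⬝ᵥ (hC.1.cfc (F t) *ᵥ v) ∂μ := by
    intro C hC
    simp only [Matrix.IsHermitian.dotProduct_cfc_mulVec]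
    rw [integral_finsetSum _ fun i _ ↦ (h _ (hC.eigenvalues_pos i)).mul_const _]
    simp only [integral_mul_const]
  rw [key A hA, key B hB]
  refine integral_mono_ae (hint A hA) (hint B hB) ?_
  filter_upwards [hF] with t ht
  exact (Matrix.IsHermitian.cfc_sub_cfc_posSemidef_iff _ _ _).1 (ht n A B hA hB hAB) v

theorem add {f g : ℝ → ℝ} (hf : OperatorMonotoneOnPos f) (hg : OperatorMonotoneOnPos g) :
    OperatorMonotoneOnPos fun x ↦ f x + g x := by
  intro n A B hA hB hAB
  rw [hA.1.cfc_add, hB.1.cfc_add, add_sub_add_comm]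
  exact (hf n A B hA hB hAB).add (hg n A B hA hB hAB)

theorem const_mul {f : ℝ → ℝ} (hf : OperatorMonotoneOnPos f) {c : ℝ} (hc : 0 ≤ c) :
    OperatorMonotoneOnPos fun x ↦ c * f x := by
  intro n A B hA hB hAB
  rw [Matrix.IsHermitian.cfc_sub_cfc_posSemidef_iff]
  intro v
  have := (Matrix.IsHermitian.cfc_sub_cfc_posSemidef_iff _ _ _).1 (hf n A B hA hB hAB) v
  simp only [Matrix.IsHermitian.dotProduct_cfc_mulVec, mul_assoc, ← Finset.mul_sum] at this ⊢
  gcongr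

theorem const (c : ℝ) : OperatorMonotoneOnPos fun _ ↦ c := by
  intro n A B hA hB _
  rw [hA.1.cfc_const, hB.1.cfc_const, sub_self]
  exact Matrix.PosSemidef.zero

theorem id : OperatorMonotoneOnPos fun x ↦ x := by
  intro n A B hA hB h
  rwa [hA.1.cfc_id', hB.1.cfc_id']

theorem parallel_sum {f g : ℝ → ℝ} (hf : OperatorMonotoneOnPos f) (hg : OperatorMonotoneOnPos g)
    (hf0 : ∀ x, 0 < x → 0 < f x) (hg0 : ∀ x, 0 < x → 0 < g x) :
    OperatorMonotoneOnPos fun x ↦ ((f x)⁻¹ + (g x)⁻¹)⁻¹ := by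
  intro n A B hA hB hAB
  have hs : ∀ x, 0 < x → 0 < (f x)⁻¹ + (g x)⁻¹ := fun x hx ↦
    add_pos (inv_pos.2 (hf0 x hx)) (inv_pos.2 (hg0 x hx))
  rw [hA.cfc_inv hs, hB.cfc_inv hs]
  refine (hB.posDef_cfc hs).inv_sub_inv_posSemidef (hA.posDef_cfc hs) ?_
  rw [hA.1.cfc_add, hB.1.cfc_add, add_sub_add_comm, hA.cfc_inv hf0, hB.cfc_inv hf0, hA.cfc_inv hg0,
    hB.cfc_inv hg0]
  exact ((hA.posDef_cfc hf0).inv_sub_inv_posSemidef (hB.posDef_cfc hf0) (hf n A B hA hB hAB)).add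
    ((hA.posDef_cfc hg0).inv_sub_inv_posSemidef (hB.posDef_cfc hg0) (hg n A B hA hB hAB))

theorem inv_comp_inv {f : ℝ → ℝ} (hf : OperatorMonotoneOnPos f) (hf0 : ∀ x, 0 < x → 0 < f x) :
    OperatorMonotoneOnPos fun x ↦ (f x⁻¹)⁻¹ := by
  intro n A B hA hB hAB
  have hs : ∀ x, 0 < x → 0 < f x⁻¹ := fun x hx ↦ hf0 _ (inv_pos.2 hx)
  rw [hA.cfc_inv hs, hB.cfc_inv hs]
  refine (hB.posDef_cfc hs).inv_sub_inv_posSemidef (hA.posDef_cfc hs) ?_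
  rw [hA.cfc_inv_arg, hB.cfc_inv_arg]
  exact hf n _ _ hB.inv hA.inv (hA.inv_sub_inv_posSemidef hB hAB)

theorem rpow_mul_rpow {f g : ℝ → ℝ} (hf : OperatorMonotoneOnPos f) (hg : OperatorMonotoneOnPos g)
    (hf0 : ∀ x, 0 < x → 0 < f x) (hg0 : ∀ x, 0 < x → 0 < g x) {p : ℝ} (hp : p ∈ Set.Ioo 0 1) :
    OperatorMonotoneOnPos fun x ↦ f x ^ (1 - p) * g x ^ p := by
  set c := ∫ t in Set.Ioi (0 : ℝ), Real.rpowIntegrand₀₁ p t 1 with hc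
  have hcpos : 0 < c := Real.integral_rpowIntegrand₀₁_one_pos hp
  have key : OperatorMonotoneOnPos fun x ↦
      ∫ t in Set.Ioi (0 : ℝ), f x * Real.rpowIntegrand₀₁ p t (g x / f x) := by
    refine integral ?_ fun x hx ↦ (Real.integrableOn_rpowIntegrand₀₁_Ioi hp
      (div_pos (hg0 x hx) (hf0 x hx)).le).const_mul _
    refine (ae_restrict_iff' measurableSet_Ioi).2 (ae_of_all _ fun t (ht : 0 < t) ↦ ?_)
    have h := ((parallel_sum hf (hg.const_mul (inv_pos.2 ht).le) hf0
      (fun x hx ↦ mul_pos (inv_pos.2 ht) (hg0 x hx))).const_mul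
        (Real.rpow_nonneg ht.le (p - 1)))
    refine h.congr fun x hx ↦ ?_
    have h1 := hf0 x hx
    have h2 := hg0 x hx
    rw [Real.rpowIntegrand₀₁_eq_pow_div hp ht.le (div_pos h2 h1).le]
    field_simp
    ring
  refine (key.const_mul (inv_pos.2 hcpos).le).congr fun x hx ↦ ?_
  have h1 := hf0 x hx
  have h2 := hg0 x hx
  rw [integral_const_mul, Real.integral_rpowIntegrand₀₁_eq_rpow_mul_const hp (div_pos h2 h1).le,
    Real.div_rpow h2.le h1.le, Real.rpow_sub h1, Real.rpow_one, ← hc]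
  have := (Real.rpow_pos_of_pos h1 p).ne'
  field_simp

theorem rpow_of_mem_Ioo {p : ℝ} (hp : p ∈ Set.Ioo 0 1) :
    OperatorMonotoneOnPos fun x ↦ x ^ p := by
  refine (rpow_mul_rpow (const 1) id (fun _ _ ↦ one_pos) (fun _ h ↦ h) hp).congr fun x _ ↦ ?_
  simp

end OperatorMonotoneOnPos

theorem binomialMean_pos (p : ℝ) {x : ℝ} (hx : 0 < x) : 0 < binomialMean p x := by
  unfold binomialMean
  split_ifs <;> positivity

theorem binomialMean_neg (p : ℝ) {x : ℝ} (hx : 0 < x) :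
    (binomialMean p x⁻¹)⁻¹ = binomialMean (-p) x := by
  unfold binomialMean
  by_cases hp : p = 0
  · simp [hp]
  · rw [if_neg hp, if_neg (neg_ne_zero.2 hp), Real.inv_rpow hx.le, Real.rpow_neg hx.le,
      one_div_neg_eq_neg_one_div, Real.rpow_neg (by positivity)]

theorem OperatorMonotoneOnPos.binomialMean_neg {p : ℝ}
    (h : OperatorMonotoneOnPos (binomialMean p)) : OperatorMonotoneOnPos (binomialMean (-p)) :=
  (h.inv_comp_inv fun _ hx ↦ binomialMean_pos p hx).congr fun _ hx ↦ _root_.binomialMean_neg p hx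

theorem OperatorMonotoneOnPos.binomialMean_of_pos {p : ℝ} (h0 : 0 < p) (h1 : p ≤ 1) :
    OperatorMonotoneOnPos (binomialMean p) := by
  rcases h1.eq_or_lt with rfl | h1
  · refine ((id.add (const 1)).const_mul (c := 1 / 2) (by norm_num)).congr fun x _ ↦ ?_
    simp [binomialMean]
    ring
  have hc : ∀ x : ℝ, 0 < x → 0 < (x ^ p + 1) / 2 := fun x hx ↦ by positivity
  have hpow : ∀ k : ℕ, OperatorMonotoneOnPos
      fun x ↦ ((x ^ p + 1) / 2) ^ ((1 - (1 - p) ^ k) / p) := by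
    intro k
    induction k with
    | zero => simpa using const 1
    | succ k ih =>
      have hpos : ∀ x : ℝ, 0 < x → 0 < ((x ^ p + 1) / 2) ^ ((1 - (1 - p) ^ k) / p) :=
        fun x hx ↦ Real.rpow_pos_of_pos (hc x hx) _
      refine (((ih.rpow_mul_rpow id hpos (fun _ h ↦ h) ⟨h0, h1⟩).add
        (ih.rpow_mul_rpow (const 1) hpos (fun _ _ ↦ one_pos) ⟨h0, h1⟩)).const_mul
          (c := 1 / 2) (by norm_num)).congr fun x hx ↦ ?_
      have he : (1 - (1 - p) ^ (k + 1)) / p = (1 - (1 - p) ^ k) / p * (1 - p) + 1 := by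
        field_simp
        ring
      rw [he, Real.rpow_add_one (hc x hx).ne', Real.rpow_mul (hc x hx).le, Real.one_rpow]
      ring
  refine of_tendsto hpow fun x hx ↦ ?_
  rw [binomialMean, if_neg h0.ne']
  have ht : Tendsto (fun k : ℕ ↦ (1 - (1 - p) ^ k) / p) atTop (𝓝 (1 / p)) := by
    simpa using ((tendsto_pow_atTop_nhds_zero_of_lt_one (sub_nonneg.2 h1.le)
      (by linarith : 1 - p < 1)).const_sub 1).div_const p
  exact (Real.continuousAt_const_rpow (hc x hx).ne').tendsto.comp ht

theorem OperatorMonotoneOnPos.binomialMean_of_mem {p : ℝ} (h1 : -1 ≤ p) (h2 : p ≤ 1) :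
    OperatorMonotoneOnPos (binomialMean p) := by
  rcases lt_trichotomy p 0 with h | rfl | h
  · simpa using (binomialMean_of_pos (neg_pos.2 h) (neg_le.1 h1)).binomialMean_neg
  · refine (rpow_of_mem_Ioo (p := 1 / 2) ⟨by norm_num, by norm_num⟩).congr fun x _ ↦ ?_
    simp [binomialMean, Real.sqrt_eq_rpow]
  · exact binomialMean_of_pos h h2

/-- A Hermitian matrix annihilated by `(X - x) (X - y)` has an affine functional calculus. -/
theorem Matrix.IsHermitian.cfc_eq_affine {n : ℕ} {A : Matrix (Fin n) (Fin n) ℝ}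
    (hA : A.IsHermitian) (f : ℝ → ℝ) {x y a b : ℝ}
    (hann : (A - x • (1 : Matrix (Fin n) (Fin n) ℝ)) * (A - y • (1 : Matrix (Fin n) (Fin n) ℝ)) = 0)
    (hx : f x = a * x + b) (hy : f y = a * y + b) :
    hA.cfc f = a • A + b • (1 : Matrix (Fin n) (Fin n) ℝ) := by
  have hspec : ∀ i, hA.eigenvalues i = x ∨ hA.eigenvalues i = y := by
    intro i
    set v : Fin n → ℝ := WithLp.ofLp (hA.eigenvectorBasis i) with hv
    have hAv : A *ᵥ v = hA.eigenvalues i • v := hA.mulVec_eigenvectorBasis i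
    have hv0 : v ≠ 0 := fun h ↦
      hA.eigenvectorBasis.orthonormal.ne_zero i ((WithLp.ofLp_eq_zero 2).1 h)
    have h0 : ((hA.eigenvalues i - x) * (hA.eigenvalues i - y)) • v = 0 := by
      have := congrArg (· *ᵥ v) hann
      simp only [← Matrix.mulVec_mulVec, Matrix.sub_mulVec, Matrix.smul_mulVec, Matrix.one_mulVec,
        hAv, Matrix.mulVec_sub, Matrix.mulVec_smul, Matrix.zero_mulVec] at this
      rw [← this]
      module
    simpa [hv0, sub_eq_zero] using h0
  have hcongr : f ∘ hA.eigenvalues = (fun z ↦ a * z + b) ∘ hA.eigenvalues := by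
    funext i
    rcases hspec i with h | h <;> simp [h, hx, hy]
  have h1 : hA.cfc f = hA.cfc fun z ↦ a * z + b := by
    rw [Matrix.IsHermitian.cfc, hcongr, Matrix.IsHermitian.cfc]
  rw [h1, hA.cfc_add, hA.cfc_const_mul_id, hA.cfc_const, Algebra.algebraMap_eq_smul_one]

theorem OperatorMonotoneOnPos.midpoint_le {f : ℝ → ℝ} (hf : OperatorMonotoneOnPos f)
    {x y ε : ℝ} (hx : 0 < x) (hy : 0 < y) (hxy : x ≠ y) (hε : 0 < ε)
    (hne : ε ≠ ((x - y) / 2) ^ 2 / ε) :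
    (f x + f y) / 2 ≤ f ((x + y) / 2 + ε) := by
  set m := (x + y) / 2 with hm
  set c := (x - y) / 2 with hc
  set d := c ^ 2 / ε with hd
  have hdε : d * ε = c ^ 2 := div_mul_cancel₀ _ hε.ne'
  have hxmc : x = m + c := by rw [hm, hc]; ring
  have hymc : y = m - c := by rw [hm, hc]; ring
  have hm0 : 0 < m := by positivity
  have hd0 : 0 ≤ d := by positivity
  have hsub : x - y ≠ 0 := sub_ne_zero.2 hxy
  have hA : (!![m, c; c, m] : Matrix (Fin 2) (Fin 2) ℝ).PosDef := by
    refine Matrix.PosDef.of_dotProduct_mulVec_pos ?_ fun v hv ↦ ?_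
    · ext i j; fin_cases i <;> fin_cases j <;> simp
    have hv' : v 0 + v 1 ≠ 0 ∨ v 0 - v 1 ≠ 0 := by
      by_contra! h
      refine hv (funext fun i ↦ ?_)
      fin_cases i <;> simp <;> linarith [h.1, h.2]
    have he : star v ⬝ᵥ ((!![m, c; c, m] : Matrix (Fin 2) (Fin 2) ℝ) *ᵥ v) =
        x / 2 * (v 0 + v 1) ^ 2 + y / 2 * (v 0 - v 1) ^ 2 := by
      simp [Matrix.mulVec, dotProduct, Fin.sum_univ_two, hxmc, hymc]
      ring
    rw [he]
    rcases hv' with h | h <;> positivity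
  have hB : (!![m + ε, 0; 0, m + d] : Matrix (Fin 2) (Fin 2) ℝ).PosDef := by
    have : (!![m + ε, 0; 0, m + d] : Matrix (Fin 2) (Fin 2) ℝ) =
        Matrix.diagonal ![m + ε, m + d] := by
      ext i j; fin_cases i <;> fin_cases j <;> simp
    rw [this]
    refine Matrix.PosDef.diagonal fun i ↦ ?_
    fin_cases i <;> simp <;> positivity
  have hAB : ((!![m + ε, 0; 0, m + d] : Matrix (Fin 2) (Fin 2) ℝ) -
      !![m, c; c, m]).PosSemidef := by
    refine Matrix.PosSemidef.of_dotProduct_mulVec_nonneg (hB.1.sub hA.1) fun v ↦ ?_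
    have he : star v ⬝ᵥ (((!![m + ε, 0; 0, m + d] : Matrix (Fin 2) (Fin 2) ℝ) -
        !![m, c; c, m]) *ᵥ v) = (ε * v 0 - c * v 1) ^ 2 / ε := by
      rw [eq_div_iff hε.ne']
      simp [Matrix.mulVec, dotProduct, Fin.sum_univ_two]
      linear_combination (v 1) ^ 2 * hdε
    rw [he]
    positivity
  have hcA := hA.1.cfc_eq_affine f (x := x) (y := y) (a := (f x - f y) / (x - y))
    (b := (x * f y - y * f x) / (x - y)) (by
      ext i j; fin_cases i <;> fin_cases j <;>
        simp [Matrix.mul_apply, Fin.sum_univ_two, hxmc, hymc])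
    (by field_simp; ring) (by field_simp; ring)
  have hsub' : (m + ε) - (m + d) ≠ 0 := by
    rw [add_sub_add_left_eq_sub]; exact sub_ne_zero.2 hne
  have hcB := hB.1.cfc_eq_affine f (x := m + ε) (y := m + d)
    (a := (f (m + ε) - f (m + d)) / ((m + ε) - (m + d)))
    (b := ((m + ε) * f (m + d) - (m + d) * f (m + ε)) / ((m + ε) - (m + d))) (by
      ext i j; fin_cases i <;> fin_cases j <;>
        simp [Matrix.mul_apply, Fin.sum_univ_two])
    (by field_simp; ring) (by field_simp; ring)
  have h := (hf 2 _ _ hA hB hAB).diag_nonneg (i := 0)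
  rw [hcA, hcB] at h
  simp only [Matrix.sub_apply, Matrix.add_apply, Matrix.smul_apply, Matrix.one_apply_eq,
    smul_eq_mul, mul_one, Matrix.of_apply, Matrix.cons_val_zero, Matrix.cons_val'] at h
  have e1 : (f x - f y) / (x - y) * m + (x * f y - y * f x) / (x - y) = (f x + f y) / 2 := by
    rw [hm]; field_simp; ring
  have e2 : (f (m + ε) - f (m + d)) / ((m + ε) - (m + d)) * (m + ε) +
      ((m + ε) * f (m + d) - (m + d) * f (m + ε)) / ((m + ε) - (m + d)) = f (m + ε) := by
    field_simp; ring
  linarith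

theorem not_operatorMonotoneOnPos_binomialMean {p : ℝ} (hp : 1 < p) :
    ¬ OperatorMonotoneOnPos (binomialMean p) := by
  intro h
  have hp0 : 0 < p := one_pos.trans hp
  set k : ℝ := (1 / 2) ^ (1 / p) with hk
  have hk0 : 0 < k := by positivity
  have hf : ∀ x : ℝ, 0 < x → binomialMean p x = k * (1 + x ^ p) ^ (1 / p) := by
    intro x hx
    rw [binomialMean, if_neg hp0.ne', hk, ← Real.mul_rpow (by norm_num) (by positivity)]
    ring_nf
  have hlt1 : ∀ x : ℝ, 0 < x → k < binomialMean p x := by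
    intro x hx
    rw [hf x hx]
    have : 0 < x ^ p := by positivity
    exact lt_mul_of_one_lt_right hk0 (Real.one_lt_rpow (by linarith) (by positivity))
  have hltx : ∀ x : ℝ, 0 < x → k * x < binomialMean p x := by
    intro x hx
    rw [hf x hx]
    have h1 : (x ^ p) ^ (1 / p) < (1 + x ^ p) ^ (1 / p) :=
      Real.rpow_lt_rpow (by positivity) (by linarith) (by positivity)
    rw [one_div, Real.rpow_rpow_inv hx.le hp0.ne', ← one_div] at h1
    gcongr
  have hupper : ∀ m : ℝ, 0 < m → binomialMean p m ≤ k * (m + m ^ (1 - p)) := by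
    intro m hm
    have hmp : 0 < m ^ p := by positivity
    have hb : (1 + (m ^ p)⁻¹) ^ (1 / p) ≤ 1 + (m ^ p)⁻¹ := by
      have := inv_pos.2 hmp
      exact Real.rpow_le_self_of_one_le (by linarith) ((div_le_one hp0).2 hp.le)
    have he : m + m ^ (1 - p) = m * (1 + (m ^ p)⁻¹) := by
      rw [Real.rpow_sub hm, Real.rpow_one]
      ring
    have hfac : 1 + m ^ p = m ^ p * (1 + (m ^ p)⁻¹) := by
      field_simp
      ring
    have hroot : (m ^ p) ^ (1 / p) = m := by
      rw [one_div, Real.rpow_rpow_inv hm.le hp0.ne']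
    rw [hf m hm, he, hfac, Real.mul_rpow hmp.le (by positivity), hroot]
    gcongr
  have ht : Tendsto (fun m : ℝ ↦ m ^ (1 - p)) atTop (𝓝 0) := by
    simpa using tendsto_rpow_neg_atTop (sub_pos.2 hp)
  obtain ⟨m, hm1, hm2⟩ := ((ht.eventually_lt_const (by norm_num : (0 : ℝ) < 1 / 8)).and
    (eventually_ge_atTop 2)).exists
  have hmid := h.midpoint_le (x := 2 * m - 3 / 8) (y := 1 / 8) (ε := 1 / 8) (by linarith)
    (by norm_num) (by linarith) (by norm_num) (by
      intro he
      rw [eq_div_iff (by norm_num)] at he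
      nlinarith)
  rw [show (2 * m - 3 / 8 + 1 / 8) / 2 + 1 / 8 = m by ring] at hmid
  have h1 := hltx (2 * m - 3 / 8) (by linarith)
  have h2 := hlt1 (1 / 8) (by norm_num)
  have h3 := hupper m (by linarith)
  nlinarith

theorem stmt_18 (p : ℝ) :
    OperatorMonotoneOnPos (binomialMean p) ↔ -1 ≤ p ∧ p ≤ 1 := by
  refine ⟨fun h ↦ ⟨?_, ?_⟩, fun h ↦ OperatorMonotoneOnPos.binomialMean_of_mem h.1 h.2⟩
  · by_contra! hp
    exact not_operatorMonotoneOnPos_binomialMean (by linarith : 1 < -p) h.binomialMean_neg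
  · by_contra! hp
    exact not_operatorMonotoneOnPos_binomialMean hp h
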